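/- Theorem 1 (loss bound for VAW on concatenated random features): under the setup below, with Φ_θ(x) = (Φ_{θ_1}(x), …, Φ_{θ_N}(x)) ∈ ℝ^{Nm} and w_t ∈ ℝ^{Nm} the VAW iterates computed from the sequence (Φ_θ(x_t), y_t), one has, for every choice of coefficient functions (γ_j)_{j=1}^N, (1/2) E_θ[Σ_{t=1}^T (⟨w_t, Φ_θ(x_t)⟩ − y_t)²] ≤ (1/2) Σ_{t=1}^T (F(x_t) − y_t)² + (λ/2 + N T)·(Σ_{j=1}^N I_j)/m + (N m Y²/2)·ln(1 + 2T/λ), where F = Σ_{j=1}^N f_j. -/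

import Mathlib

open MeasureTheory

/-- The Vovk–Azoury–Warmuth (VAW) iterates with regularization parameter `lam`,
applied to input vectors `u 1, u 2, …` (indexed by a finite type `ι`) and labels
`y 1, y 2, …`:  `w t = S t ⁻¹ (∑_{i=1}^{t-1} y i • u i)`, where
`S t = lam • I + ∑_{i=1}^{t} (u i) (u i)ᵀ` (positive definite, hence the matrix
inverse is the true inverse). -/
noncomputable def vaw {ι : Type*} [Fintype ι] [DecidableEq ι] (lam : ℝ)
    (u : ℕ → ι → ℝ) (y : ℕ → ℝ) (t : ℕ) : ι → ℝ :=
  ((lam • (1 : Matrix ι ι ℝ) + ∑ i ∈ Finset.Icc 1 t, Matrix.vecMulVec (u i) (u i))⁻¹).mulVec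
    (∑ i ∈ Finset.Icc 1 (t - 1), y i • u i)

section Gram

open Matrix

/-- Fenchel–Young inequality for the quadratic form of a positive definite matrix. -/
lemma Matrix.PosDef.two_mul_dotProduct_sub_le {ι : Type*} [Fintype ι] [DecidableEq ι]
    {A : Matrix ι ι ℝ} (hA : A.PosDef) (b v : ι → ℝ) :
    2 * (v ⬝ᵥ b) - v ⬝ᵥ (A *ᵥ v) ≤ b ⬝ᵥ (A⁻¹ *ᵥ b) := by
  have hdet : IsUnit A.det := hA.det_pos.ne'.isUnit
  set z := A⁻¹ *ᵥ b with hz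
  have hAz : A *ᵥ z = b := by
    rw [hz, mulVec_mulVec, mul_nonsing_inv _ hdet, one_mulVec]
  have hsymm : z ⬝ᵥ (A *ᵥ v) = v ⬝ᵥ b := by
    have hAt : Aᵀ = A := by simpa using hA.isHermitian.eq
    rw [dotProduct_mulVec, ← mulVec_transpose, hAt, hAz, dotProduct_comm]
  have hnonneg := hA.posSemidef.dotProduct_mulVec_nonneg (v - z)
  simp only [star_trivial, mulVec_sub, sub_dotProduct, dotProduct_sub, hAz, hsymm] at hnonneg
  rw [dotProduct_comm b z]
  linarith

/-- A rank-one update `A = a + u uᵀ` satisfies `uᵀ A⁻¹ u ≤ log det A - log det a`. -/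
lemma Matrix.PosDef.dotProduct_inv_mulVec_le_log_det_sub {ι : Type*} [Fintype ι] [DecidableEq ι]
    {a : Matrix ι ι ℝ} (ha : a.PosDef)
    (u : ι → ℝ) (hA : (a + vecMulVec u u).PosDef) :
    u ⬝ᵥ ((a + vecMulVec u u)⁻¹ *ᵥ u) ≤
      Real.log (a + vecMulVec u u).det - Real.log a.det := by
  set A := a + vecMulVec u u with hAdef
  have hdet : a.det = A.det * (1 - u ⬝ᵥ (A⁻¹ *ᵥ u)) := by
    have h := det_add_replicateCol_mul_replicateRow (ι := Unit) hA.det_pos.ne'.isUnit (-u) u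
    have h1 : A + replicateCol Unit (-u) * replicateRow Unit u = a := by
      rw [← vecMulVec_eq, neg_vecMulVec, hAdef]
      abel
    have h2 : (1 + replicateRow Unit u * A⁻¹ * replicateCol Unit (-u)).det =
        1 - u ⬝ᵥ (A⁻¹ *ᵥ u) := by
      rw [det_unique, add_apply, one_apply_eq, Matrix.mul_assoc, ← replicateCol_mulVec,
        replicateRow_mul_replicateCol_apply, mulVec_neg, dotProduct_neg, sub_eq_add_neg]
    rw [← h2, ← h, h1]
  have hpos : 0 < 1 - u ⬝ᵥ (A⁻¹ *ᵥ u) :=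
    pos_of_mul_pos_right (hdet ▸ ha.det_pos) hA.det_pos.le
  rw [hdet, Real.log_mul hA.det_pos.ne' hpos.ne']
  linarith [Real.log_le_sub_one_of_pos hpos]

/-- AM–GM for the eigenvalues: a trace bound controls the log-determinant. -/
lemma Matrix.PosDef.log_det_le {ι : Type*} [Fintype ι] [DecidableEq ι]
    {A : Matrix ι ι ℝ} (hA : A.PosDef) {c : ℝ} (hc : 0 < c)
    (htr : A.trace ≤ Fintype.card ι * c) :
    Real.log A.det ≤ Fintype.card ι * Real.log c := by
  have hlog : ∀ i, Real.log (hA.1.eigenvalues i) ≤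
      hA.1.eigenvalues i / c - 1 + Real.log c := fun i => by
    have h := Real.log_le_sub_one_of_pos (div_pos (hA.eigenvalues_pos i) hc)
    rw [Real.log_div (hA.eigenvalues_pos i).ne' hc.ne'] at h
    linarith
  have htr' : A.trace = ∑ i, hA.1.eigenvalues i := by
    simpa using hA.1.trace_eq_sum_eigenvalues
  have hdet : A.det = ∏ i, hA.1.eigenvalues i := by
    simpa using hA.1.det_eq_prod_eigenvalues
  rw [hdet, Real.log_prod (fun i _ => (hA.eigenvalues_pos i).ne')]
  calc ∑ i, Real.log (hA.1.eigenvalues i)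
      ≤ ∑ i, (hA.1.eigenvalues i / c - 1 + Real.log c) := Finset.sum_le_sum fun i _ => hlog i
    _ = A.trace / c - Fintype.card ι + Fintype.card ι * Real.log c := by
        rw [htr', Finset.sum_add_distrib, Finset.sum_sub_distrib, Finset.sum_div]
        simp
    _ ≤ _ := by
        have : A.trace / c ≤ Fintype.card ι := (div_le_iff₀ hc).2 htr
        linarith

/-- The regularized Gram matrix `S t` of the VAW algorithm. -/
noncomputable def vawGram {ι : Type*} [DecidableEq ι]
    (lam : ℝ) (u : ℕ → ι → ℝ) (t : ℕ) : Matrix ι ι ℝ :=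
  lam • (1 : Matrix ι ι ℝ) + ∑ i ∈ Finset.Icc 1 t, vecMulVec (u i) (u i)

lemma vawGram_succ {ι : Type*} [DecidableEq ι]
    (lam : ℝ) (u : ℕ → ι → ℝ) (t : ℕ) :
    vawGram lam u (t + 1) = vawGram lam u t + vecMulVec (u (t + 1)) (u (t + 1)) := by
  rw [vawGram, vawGram, Finset.sum_Icc_succ_top (by omega), add_assoc]

lemma vawGram_posDef {ι : Type*} [Fintype ι] [DecidableEq ι]
    {lam : ℝ} (hlam : 0 < lam) (u : ℕ → ι → ℝ) (t : ℕ) :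
    (vawGram lam u t).PosDef :=
  (PosDef.one.smul hlam).add_posSemidef <|
    posSemidef_sum _ fun i _ => by simpa using posSemidef_vecMulVec_self_star (u i)

lemma dotProduct_vawGram_mulVec {ι : Type*} [Fintype ι] [DecidableEq ι]
    (lam : ℝ) (u : ℕ → ι → ℝ) (t : ℕ) (v : ι → ℝ) :
    v ⬝ᵥ (vawGram lam u t *ᵥ v) =
      lam * (v ⬝ᵥ v) + ∑ i ∈ Finset.Icc 1 t, (v ⬝ᵥ u i) ^ 2 := by
  rw [vawGram, add_mulVec, smul_mulVec, one_mulVec, dotProduct_add, dotProduct_smul,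
    sum_mulVec, dotProduct_sum, smul_eq_mul]
  congr 1
  refine Finset.sum_congr rfl fun i _ => ?_
  simp [vecMulVec_mulVec, dotProduct_comm (u i) v, sq]

lemma trace_vawGram {ι : Type*} [Fintype ι] [DecidableEq ι]
    (lam : ℝ) (u : ℕ → ι → ℝ) (t : ℕ) :
    (vawGram lam u t).trace =
      Fintype.card ι * lam + ∑ i ∈ Finset.Icc 1 t, u i ⬝ᵥ u i := by
  simp [vawGram, trace_sum, trace_vecMulVec, mul_comm]

/-- One-step progress bound for the VAW prediction, where `a`, `b` are the Gram matrix and the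
label-weighted sum of the previous inputs, and `(u, y)` is the next example. -/
lemma vaw_step {ι : Type*} [Fintype ι] [DecidableEq ι]
    {a : Matrix ι ι ℝ} (ha : a.PosDef) (u b : ι → ℝ)
    (hA : (a + vecMulVec u u).PosDef) (y : ℝ) :
    (((a + vecMulVec u u)⁻¹ *ᵥ b) ⬝ᵥ u - y) ^ 2 ≤
      y ^ 2 - (b + y • u) ⬝ᵥ ((a + vecMulVec u u)⁻¹ *ᵥ (b + y • u)) + b ⬝ᵥ (a⁻¹ *ᵥ b)
        + y ^ 2 * (Real.log (a + vecMulVec u u).det - Real.log a.det) := by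
  have hlog := mul_le_mul_of_nonneg_left (ha.dotProduct_inv_mulVec_le_log_det_sub u hA)
    (sq_nonneg y)
  set A := a + vecMulVec u u with hAdef
  set z := A⁻¹ *ᵥ b with hz
  have hfy := ha.two_mul_dotProduct_sub_le b z
  have hAz : A *ᵥ z = b := by
    rw [hz, mulVec_mulVec, mul_nonsing_inv _ hA.det_pos.ne'.isUnit, one_mulVec]
  have hquad : z ⬝ᵥ b = z ⬝ᵥ (a *ᵥ z) + (z ⬝ᵥ u) ^ 2 := by
    conv_lhs => rw [← hAz, hAdef, add_mulVec, dotProduct_add]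
    simp [vecMulVec_mulVec, dotProduct_comm u z, sq]
  have hsymm : b ⬝ᵥ (A⁻¹ *ᵥ u) = z ⬝ᵥ u := by
    have hAt : A⁻¹ᵀ = A⁻¹ := by simpa using hA.inv.isHermitian.eq
    rw [dotProduct_mulVec, ← mulVec_transpose, hAt]
  simp only [mulVec_add, mulVec_smul, add_dotProduct, dotProduct_add, smul_dotProduct,
    dotProduct_smul, smul_eq_mul, ← hz, hsymm, dotProduct_comm u z, dotProduct_comm b z]
  nlinarith

/-- Regret bound for the VAW algorithm, with the regret measured by log-determinants. -/
lemma vaw_sum_sq_le {ι : Type*} [Fintype ι] [DecidableEq ι]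
    {lam Y : ℝ} (hlam : 0 < lam) (u : ℕ → ι → ℝ) (y : ℕ → ℝ)
    (T : ℕ) (hy : ∀ t ∈ Finset.Icc 1 T, |y t| ≤ Y) (v : ι → ℝ) :
    ∑ t ∈ Finset.Icc 1 T, (vaw lam u y t ⬝ᵥ u t - y t) ^ 2 ≤
      ∑ t ∈ Finset.Icc 1 T, (v ⬝ᵥ u t - y t) ^ 2 + lam * (v ⬝ᵥ v)
        + Y ^ 2 * (Real.log (vawGram lam u T).det - Real.log (vawGram lam u 0).det) := by
  have hpot : ∀ n ≤ T, ∑ t ∈ Finset.Icc 1 n, (vaw lam u y t ⬝ᵥ u t - y t) ^ 2 ≤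
      ∑ t ∈ Finset.Icc 1 n, y t ^ 2
        - (∑ i ∈ Finset.Icc 1 n, y i • u i) ⬝ᵥ
            ((vawGram lam u n)⁻¹ *ᵥ ∑ i ∈ Finset.Icc 1 n, y i • u i)
        + Y ^ 2 * (Real.log (vawGram lam u n).det - Real.log (vawGram lam u 0).det) := by
    intro n
    induction n with
    | zero => simp
    | succ n ih =>
      intro hn
      have ih := ih (by omega)
      have ha := vawGram_posDef hlam u n
      have hA := vawGram_posDef hlam u (n + 1)
      have hw : vaw lam u y (n + 1) =
          (vawGram lam u (n + 1))⁻¹ *ᵥ ∑ i ∈ Finset.Icc 1 n, y i • u i := rfl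
      have hyn : y (n + 1) ^ 2 ≤ Y ^ 2 :=
        sq_le_sq.2 ((hy (n + 1) (Finset.mem_Icc.2 ⟨by omega, hn⟩)).trans (le_abs_self Y))
      rw [vawGram_succ] at hA hw
      have hstep := vaw_step ha (u (n + 1)) (∑ i ∈ Finset.Icc 1 n, y i • u i) hA (y (n + 1))
      have hlog : 0 ≤ Real.log (vawGram lam u n + vecMulVec (u (n + 1)) (u (n + 1))).det
          - Real.log (vawGram lam u n).det :=
        le_trans (by simpa using hA.inv.posSemidef.dotProduct_mulVec_nonneg (u (n + 1)))
          (ha.dotProduct_inv_mulVec_le_log_det_sub (u (n + 1)) hA)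
      have hmul := mul_le_mul_of_nonneg_right hyn hlog
      simp only [Finset.sum_Icc_succ_top (show 1 ≤ n + 1 by omega), vawGram_succ, hw]
      linarith
  have hfy := (vawGram_posDef hlam u T).two_mul_dotProduct_sub_le
    (∑ i ∈ Finset.Icc 1 T, y i • u i) v
  have hexp : ∑ t ∈ Finset.Icc 1 T, (v ⬝ᵥ u t - y t) ^ 2 =
      ∑ t ∈ Finset.Icc 1 T, (v ⬝ᵥ u t) ^ 2 - 2 * (v ⬝ᵥ ∑ i ∈ Finset.Icc 1 T, y i • u i)
        + ∑ t ∈ Finset.Icc 1 T, y t ^ 2 := by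
    rw [dotProduct_sum, Finset.mul_sum, ← Finset.sum_sub_distrib, ← Finset.sum_add_distrib]
    refine Finset.sum_congr rfl fun t _ => ?_
    rw [dotProduct_smul, smul_eq_mul]
    ring
  rw [dotProduct_vawGram_mulVec] at hfy
  linarith [hpot T le_rfl]

/-- Regret bound for the VAW algorithm on input vectors with bounded coordinates. -/
lemma vaw_regret_bound {ι : Type*} [Fintype ι] [DecidableEq ι]
    {lam Y B : ℝ} (hlam : 0 < lam) (u : ℕ → ι → ℝ)
    (hu : ∀ t i, u t i ^ 2 ≤ B) (hB : 0 ≤ B) (y : ℕ → ℝ)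
    (T : ℕ) (hy : ∀ t ∈ Finset.Icc 1 T, |y t| ≤ Y) (v : ι → ℝ) :
    ∑ t ∈ Finset.Icc 1 T, (vaw lam u y t ⬝ᵥ u t - y t) ^ 2 ≤
      ∑ t ∈ Finset.Icc 1 T, (v ⬝ᵥ u t - y t) ^ 2 + lam * (v ⬝ᵥ v)
        + Fintype.card ι * Y ^ 2 * Real.log (1 + B * T / lam) := by
  have hc : 0 < lam + B * T := by positivity
  have htr : (vawGram lam u T).trace ≤ Fintype.card ι * (lam + B * T) := by
    have hnorm : ∀ t ∈ Finset.Icc 1 T, u t ⬝ᵥ u t ≤ Fintype.card ι * B := fun t _ => by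
      simpa [dotProduct, ← sq] using Finset.sum_le_card_nsmul Finset.univ _ B fun i _ => hu t i
    have hsum := Finset.sum_le_card_nsmul _ _ _ hnorm
    rw [Nat.card_Icc, Nat.add_sub_cancel, nsmul_eq_mul] at hsum
    rw [trace_vawGram]
    linarith
  have hdet := (vawGram_posDef hlam u T).log_det_le hc htr
  have hdet0 : Real.log (vawGram lam u 0).det = Fintype.card ι * Real.log lam := by
    simp [vawGram]
  have hlog : Real.log (1 + B * T / lam) = Real.log (lam + B * T) - Real.log lam := by
    rw [← Real.log_div hc.ne' hlam.ne', add_div, div_self hlam.ne']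
  refine (vaw_sum_sq_le hlam u y T hy v).trans ?_
  rw [hlog, hdet0]
  have := mul_le_mul_of_nonneg_left hdet (sq_nonneg Y)
  linarith

end Gram

section ProductMeasure

open ProbabilityTheory

lemma MeasureTheory.MemLp.sum_comp_eval_pi {ι : Type*} [Fintype ι] {Ω : ι → Type*}
    [∀ i, MeasurableSpace (Ω i)] {P : ∀ i, Measure (Ω i)} [∀ i, IsProbabilityMeasure (P i)]
    {X : ∀ i, Ω i → ℝ} {q : ENNReal} (hX : ∀ i, MemLp (X i) q (P i)) :
    MemLp (fun ω => ∑ i, X i (ω i)) q (Measure.pi P) :=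
  memLp_finsetSum _ fun i _ => (hX i).comp_measurePreserving (measurePreserving_eval P i)

lemma MeasureTheory.integral_sum_comp_eval_pi {ι : Type*} [Fintype ι] {Ω : ι → Type*}
    [∀ i, MeasurableSpace (Ω i)] {P : ∀ i, Measure (Ω i)} [∀ i, IsProbabilityMeasure (P i)]
    {X : ∀ i, Ω i → ℝ} (hX : ∀ i, Integrable (X i) (P i)) :
    ∫ ω, ∑ i, X i (ω i) ∂(Measure.pi P) = ∑ i, ∫ θ, X i θ ∂(P i) := by
  rw [integral_finsetSum Finset.univ (f := fun i (ω : ∀ i, Ω i) => X i (ω i)) fun i _ =>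
    (measurePreserving_eval P i).integrable_comp_of_integrable (hX i)]
  exact Finset.sum_congr rfl fun i _ => integral_comp_eval (f := X i) (hX i).aestronglyMeasurable

lemma ProbabilityTheory.variance_sum_comp_eval_pi {ι : Type*} [Fintype ι] {Ω : ι → Type*}
    [∀ i, MeasurableSpace (Ω i)] {P : ∀ i, Measure (Ω i)} [∀ i, IsProbabilityMeasure (P i)]
    {X : ∀ i, Ω i → ℝ} (hX : ∀ i, MemLp (X i) 2 (P i)) :
    Var[fun ω => ∑ i, X i (ω i); Measure.pi P] = ∑ i, Var[X i; P i] := by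
  rw [← variance_sum_pi hX]
  congr 1
  ext ω
  simp

lemma ProbabilityTheory.integral_sub_const_sq {Ω : Type*} [MeasurableSpace Ω] {P : Measure Ω}
    [IsProbabilityMeasure P] {Z : Ω → ℝ} (hZ : MemLp Z 2 P) (c : ℝ) :
    ∫ ω, (Z ω - c) ^ 2 ∂P = (∫ ω, Z ω ∂P - c) ^ 2 + Var[Z; P] := by
  have hvar := variance_eq_sub (hZ.sub (memLp_const c))
  rw [show Z - (fun _ => c) = fun ω => Z ω - c from rfl,
    variance_sub_const hZ.aestronglyMeasurable,
    integral_sub (hZ.integrable one_le_two) (integrable_const c)] at hvar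
  simp only [integral_const, probReal_univ, one_smul, Pi.pow_apply] at hvar
  linarith

/-- Bias–variance bound for an average of `m` independent samples in each of several groups. -/
lemma ProbabilityTheory.integral_sq_sum_average_sub_le {ι : Type*} [Fintype ι] {Ω : ι → Type*}
    [∀ i, MeasurableSpace (Ω i)] {P : ∀ i, Measure (Ω i)} [∀ i, IsProbabilityMeasure (P i)]
    {X : ∀ i, Ω i → ℝ} (hX : ∀ i, MemLp (X i) 2 (P i)) {m : ℕ} (hm : 0 < m) (c : ℝ) :
    ∫ ω, (∑ i, ∑ k, X i (ω i k) / m - c) ^ 2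
        ∂(Measure.pi fun i => Measure.pi fun _ : Fin m => P i) ≤
      (∑ i, ∫ θ, X i θ ∂(P i) - c) ^ 2 + (∑ i, ∫ θ, X i θ ^ 2 ∂(P i)) / m := by
  have hm' : (m : ℝ) ≠ 0 := by positivity
  have hXm : ∀ i, MemLp (fun θ => X i θ / m) 2 (P i) := fun i => by
    simpa only [div_eq_mul_inv] using (hX i).mul_const (m : ℝ)⁻¹
  have hW : ∀ i, MemLp (fun η : Fin m → Ω i => ∑ k, X i (η k) / m) 2
      (Measure.pi fun _ => P i) := fun i =>
    MemLp.sum_comp_eval_pi (X := fun _ θ => X i θ / m) fun _ => hXm i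
  have hWint : ∀ i, ∫ η : Fin m → Ω i, ∑ k, X i (η k) / m ∂(Measure.pi fun _ => P i) =
      ∫ θ, X i θ ∂(P i) := fun i => by
    rw [integral_sum_comp_eval_pi (X := fun _ θ => X i θ / m)
      fun _ => (hXm i).integrable one_le_two]
    simp only [integral_div, Finset.sum_const, Finset.card_univ, Fintype.card_fin, nsmul_eq_mul]
    field_simp
  have hWvar : ∀ i, Var[fun η : Fin m → Ω i => ∑ k, X i (η k) / m; Measure.pi fun _ => P i] ≤
      (∫ θ, X i θ ^ 2 ∂(P i)) / m := fun i => by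
    rw [variance_sum_comp_eval_pi (X := fun _ θ => X i θ / m) fun _ => hXm i]
    simp only [div_eq_inv_mul, variance_const_mul, Finset.sum_const, Finset.card_univ,
      Fintype.card_fin, nsmul_eq_mul]
    have h := variance_le_expectation_sq (hX i).aestronglyMeasurable
    simp only [Pi.pow_apply] at h
    calc (m : ℝ) * ((m : ℝ)⁻¹ ^ 2 * Var[X i; P i]) = (m : ℝ)⁻¹ * Var[X i; P i] := by
          field_simp
      _ ≤ _ := by gcongr
  rw [integral_sub_const_sq
      (MemLp.sum_comp_eval_pi (X := fun i (η : Fin m → Ω i) => ∑ k, X i (η k) / m) hW),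
    integral_sum_comp_eval_pi (X := fun i (η : Fin m → Ω i) => ∑ k, X i (η k) / m)
      fun i => (hW i).integrable one_le_two,
    variance_sum_comp_eval_pi (X := fun i (η : Fin m → Ω i) => ∑ k, X i (η k) / m) hW,
    Finset.sum_div]
  simp only [hWint]
  gcongr with i
  exact hWvar i

end ProductMeasure

section ImportanceWeight

lemma MeasureTheory.integral_withDensity_ofReal {α : Type*} [MeasurableSpace α] {μ : Measure α}
    {p : α → ℝ} (hp : Measurable p) (hp0 : ∀ θ, 0 ≤ p θ)
    (g : α → ℝ) :
    ∫ θ, g θ ∂(μ.withDensity fun θ => ENNReal.ofReal (p θ)) = ∫ θ, p θ * g θ ∂μ := by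
  rw [integral_withDensity_eq_integral_toReal_smul hp.ennreal_ofReal (by simp)]
  simp [ENNReal.toReal_ofReal (hp0 _)]

lemma mul_div_sq_eq_sq_div (a b : ℝ) : b * (a / b) ^ 2 = a ^ 2 / b := by
  rcases eq_or_ne b 0 with rfl | hb
  · simp
  · field_simp

lemma MeasureTheory.memLp_two_div_withDensity {α : Type*} [MeasurableSpace α] {μ : Measure α}
    {p γ : α → ℝ} (hp : Measurable p) (hp0 : ∀ θ, 0 ≤ p θ)
    (hγ : Measurable γ) (hI : Integrable (fun θ => γ θ ^ 2 / p θ) μ) :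
    MemLp (fun θ => γ θ / p θ) 2 (μ.withDensity fun θ => ENNReal.ofReal (p θ)) := by
  rw [memLp_two_iff_integrable_sq (f := fun θ => γ θ / p θ) (hγ.div hp).aestronglyMeasurable,
    integrable_withDensity_iff_integrable_smul' hp.ennreal_ofReal (by simp)]
  simpa [ENNReal.toReal_ofReal (hp0 _), mul_div_sq_eq_sq_div] using hI

lemma MeasureTheory.integral_div_mul_withDensity {α : Type*} [MeasurableSpace α] {μ : Measure α}
    {p γ : α → ℝ} (hp : Measurable p) (hp0 : ∀ θ, 0 ≤ p θ)
    (hpos : ∀ᵐ θ ∂μ, 0 < p θ) (g : α → ℝ) :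
    ∫ θ, γ θ / p θ * g θ ∂(μ.withDensity fun θ => ENNReal.ofReal (p θ)) =
      ∫ θ, γ θ * g θ ∂μ := by
  rw [integral_withDensity_ofReal hp hp0]
  refine integral_congr_ae ?_
  filter_upwards [hpos] with θ hθ
  field_simp

end ImportanceWeight

/-- **Theorem 1: loss bound for VAW on concatenated random features.**
For `j = 1,…,N`: `(Θⱼ, μⱼ)` σ-finite, `pⱼ` probability densities (`∫ pⱼ dμⱼ = 1`,
`pⱼ > 0` a.e.), `φⱼ` measurable with `|φⱼ| ≤ √2`, `γⱼ` measurable with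
`Iⱼ = ∫ γⱼ²/pⱼ dμⱼ < ∞`, `fⱼ(x) = ∫ γⱼ(θ) φⱼ(x,θ) dμⱼ(θ)`, `F = ∑ⱼ fⱼ`.
The independent family `(θⱼₖ)`, `θⱼₖ ~ pⱼ·μⱼ`, is modelled by the product measure.
The VAW iterates `w t ∈ ℝ^{Nm}` are computed from the concatenated features
`Φ_θ(x_t) = (φⱼ(x_t, θⱼₖ))_{j,k}`.  With `|y_t| ≤ Y`:
`(1/2) E_θ[∑ₜ (⟨w_t, Φ_θ(x_t)⟩ − y_t)²] ≤ (1/2) ∑ₜ (F(x_t) − y_t)²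
  + (λ/2 + NT)(∑ⱼ Iⱼ)/m + (N m Y²/2) ln(1 + 2T/λ)`. -/
theorem vaw_concatenated_random_features_loss_bound
    (d N m T : ℕ) (hm : 0 < m) (lam Y : ℝ) (hlam : 0 < lam) (hY : 0 < Y)
    (Θ : Fin N → Type*) [∀ j, MeasurableSpace (Θ j)]
    (μ : ∀ j, Measure (Θ j)) [∀ j, SigmaFinite (μ j)]
    (p : ∀ j, Θ j → ℝ) (hp_meas : ∀ j, Measurable (p j))
    (hp_nonneg : ∀ j θ, 0 ≤ p j θ)
    (hp_prob : ∀ j, ∫⁻ θ, ENNReal.ofReal (p j θ) ∂(μ j) = 1)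
    (hp_pos : ∀ j, ∀ᵐ θ ∂(μ j), 0 < p j θ)
    (φ : ∀ j, (Fin d → ℝ) → Θ j → ℝ)
    (hφ_meas : ∀ j, Measurable (fun q : (Fin d → ℝ) × Θ j => φ j q.1 q.2))
    (hφ_bdd : ∀ j x θ, |φ j x θ| ≤ Real.sqrt 2)
    (γ : ∀ j, Θ j → ℝ) (hγ_meas : ∀ j, Measurable (γ j))
    (hI : ∀ j, Integrable (fun θ => γ j θ ^ 2 / p j θ) (μ j))
    (f : ∀ j, (Fin d → ℝ) → ℝ)
    (hf : ∀ j x, f j x = ∫ θ, γ j θ * φ j x θ ∂(μ j))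
    (x : ℕ → Fin d → ℝ) (y : ℕ → ℝ)
    (hy : ∀ t ∈ Finset.Icc 1 T, |y t| ≤ Y) :
    (1 / 2) * ∫ ω : ∀ j, Fin m → Θ j,
        (∑ t ∈ Finset.Icc 1 T,
          ((∑ jk : Fin N × Fin m,
              vaw lam (fun s jk' => φ jk'.1 (x s) (ω jk'.1 jk'.2)) y t jk
                * φ jk.1 (x t) (ω jk.1 jk.2)) - y t) ^ 2)
        ∂(Measure.pi fun j =>
            Measure.pi fun _ : Fin m => (μ j).withDensity fun θ => ENNReal.ofReal (p j θ))
      ≤ (1 / 2) * ∑ t ∈ Finset.Icc 1 T, ((∑ j, f j (x t)) - y t) ^ 2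
        + (lam / 2 + N * T) * (∑ j, ∫ θ, γ j θ ^ 2 / p j θ ∂(μ j)) / m
        + N * m * Y ^ 2 / 2 * Real.log (1 + 2 * T / lam) := by
  set P : ∀ j, Measure (Θ j) := fun j => (μ j).withDensity fun θ => ENNReal.ofReal (p j θ) with hP
  have hprob : ∀ j, IsProbabilityMeasure (P j) := fun j =>
    ⟨by rw [hP, withDensity_apply _ MeasurableSet.univ, setLIntegral_univ, hp_prob j]⟩
  set I : Fin N → ℝ := fun j => ∫ θ, γ j θ ^ 2 / p j θ ∂(μ j) with hI_def
  set Q : Measure (∀ j, Fin m → Θ j) := Measure.pi fun j => Measure.pi fun _ : Fin m => P j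
  have hm' : (m : ℝ) ≠ 0 := by positivity
  have hφ_sq : ∀ j z θ, φ j z θ ^ 2 ≤ 2 := fun j z θ => by
    have h := pow_le_pow_left₀ (abs_nonneg _) (hφ_bdd j z θ) 2
    rwa [sq_abs, Real.sq_sqrt zero_le_two] at h
  have hφ_meas' : ∀ j z, Measurable (φ j z) := fun j z =>
    (hφ_meas j).comp measurable_prodMk_left
  have hI_nonneg : ∀ j, 0 ≤ I j := fun j =>
    integral_nonneg fun θ => div_nonneg (sq_nonneg _) (hp_nonneg j θ)
  have hg : ∀ j, MemLp (fun θ => γ j θ / p j θ) 2 (P j) := fun j =>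
    memLp_two_div_withDensity (hp_meas j) (hp_nonneg j) (hγ_meas j) (hI j)
  have hg_sq : ∀ j, ∫ θ, (γ j θ / p j θ) ^ 2 ∂(P j) = I j := fun j => by
    rw [hP, integral_withDensity_ofReal (hp_meas j) (hp_nonneg j)]
    simp only [mul_div_sq_eq_sq_div, hI_def]
  have hX : ∀ j z, MemLp (fun θ => γ j θ / p j θ * φ j z θ) 2 (P j) := fun j z =>
    MemLp.mul' (r := 2) (memLp_top_of_bound (hφ_meas' j z).aestronglyMeasurable _
      (Filter.Eventually.of_forall fun θ => hφ_bdd j z θ)) (hg j)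
  have hX_int : ∀ j z, ∫ θ, γ j θ / p j θ * φ j z θ ∂(P j) = f j z := fun j z => by
    rw [hf, hP, integral_div_mul_withDensity (hp_meas j) (hp_nonneg j) (hp_pos j)]
  have hX_sq : ∀ j z, ∫ θ, (γ j θ / p j θ * φ j z θ) ^ 2 ∂(P j) ≤ 2 * I j := fun j z => by
    rw [← hg_sq, ← integral_const_mul]
    refine integral_mono (hX j z).integrable_sq ((hg j).integrable_sq.const_mul 2) fun θ => ?_
    simp only [mul_pow]
    nlinarith [hφ_sq j z θ, sq_nonneg (γ j θ / p j θ)]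
  -- the random comparator and its predictions
  let v : (∀ j, Fin m → Θ j) → Fin N × Fin m → ℝ :=
    fun ω jk => γ jk.1 (ω jk.1 jk.2) / p jk.1 (ω jk.1 jk.2) / m
  let Z : ℕ → (∀ j, Fin m → Θ j) → ℝ :=
    fun t ω => ∑ j, ∑ k, γ j (ω j k) / p j (ω j k) * φ j (x t) (ω j k) / m
  have hZ : ∀ t, MemLp (Z t) 2 Q := fun t =>
    MemLp.sum_comp_eval_pi
      (X := fun j (η : Fin m → Θ j) => ∑ k, γ j (η k) / p j (η k) * φ j (x t) (η k) / m)
      fun j => MemLp.sum_comp_eval_pi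
        (X := fun _ θ => γ j θ / p j θ * φ j (x t) θ / m) fun _ => by
          simpa only [div_eq_mul_inv] using (hX j (x t)).mul_const (m : ℝ)⁻¹
  have hZ_int : ∀ t, Integrable (fun ω => (Z t ω - y t) ^ 2) Q := fun t =>
    ((hZ t).sub (memLp_const (y t))).integrable_sq
  have hZ_le : ∀ t, ∫ ω, (Z t ω - y t) ^ 2 ∂Q ≤
      ((∑ j, f j (x t)) - y t) ^ 2 + 2 * (∑ j, I j) / m := fun t => by
    refine (ProbabilityTheory.integral_sq_sum_average_sub_le
      (fun j => hX j (x t)) hm (y t)).trans ?_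
    simp only [hX_int]
    rw [Finset.mul_sum]
    gcongr
    exact hX_sq _ (x t)
  let R : (∀ j, Fin m → Θ j) → ℝ :=
    fun ω => ∑ j, ∑ k, (γ j (ω j k) / p j (ω j k)) ^ 2 / (m : ℝ) ^ 2
  have hsq_int : ∀ j, Integrable (fun θ => (γ j θ / p j θ) ^ 2 / (m : ℝ) ^ 2) (P j) := fun j =>
    (hg j).integrable_sq.div_const _
  have hR_inner : ∀ j, Integrable
      (fun η : Fin m → Θ j => ∑ k, (γ j (η k) / p j (η k)) ^ 2 / (m : ℝ) ^ 2)
      (Measure.pi fun _ => P j) := fun j =>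
    memLp_one_iff_integrable.1 <| MemLp.sum_comp_eval_pi
      (X := fun _ θ => (γ j θ / p j θ) ^ 2 / (m : ℝ) ^ 2)
      fun _ => memLp_one_iff_integrable.2 (hsq_int j)
  have hR : Integrable R Q :=
    memLp_one_iff_integrable.1 <| MemLp.sum_comp_eval_pi
      (X := fun j (η : Fin m → Θ j) => ∑ k, (γ j (η k) / p j (η k)) ^ 2 / (m : ℝ) ^ 2)
      fun j => memLp_one_iff_integrable.2 (hR_inner j)
  have hR_eq : ∫ ω, R ω ∂Q = (∑ j, I j) / m := by
    rw [integral_sum_comp_eval_pi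
      (X := fun j (η : Fin m → Θ j) => ∑ k, (γ j (η k) / p j (η k)) ^ 2 / (m : ℝ) ^ 2) hR_inner,
      Finset.sum_div]
    refine Finset.sum_congr rfl fun j _ => ?_
    rw [integral_sum_comp_eval_pi
      (X := fun _ θ => (γ j θ / p j θ) ^ 2 / (m : ℝ) ^ 2) fun _ => hsq_int j]
    simp only [integral_div, hg_sq, Finset.sum_const, Finset.card_univ, Fintype.card_fin,
      nsmul_eq_mul]
    field_simp
  set C : ℝ := N * m * Y ^ 2 * Real.log (1 + 2 * T / lam) with hC
  have hsum_int : Integrable (fun ω => ∑ t ∈ Finset.Icc 1 T, (Z t ω - y t) ^ 2) Q :=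
    integrable_finsetSum _ fun t _ => hZ_int t
  have hmono := integral_mono_of_nonneg (μ := Q)
    (f := fun ω => ∑ t ∈ Finset.Icc 1 T,
      ((∑ jk : Fin N × Fin m,
        vaw lam (fun s jk' => φ jk'.1 (x s) (ω jk'.1 jk'.2)) y t jk
          * φ jk.1 (x t) (ω jk.1 jk.2)) - y t) ^ 2)
    (g := fun ω => ∑ t ∈ Finset.Icc 1 T, (Z t ω - y t) ^ 2 + lam * R ω + C)
    (Filter.Eventually.of_forall fun ω => Finset.sum_nonneg fun t _ => sq_nonneg _)
    ((hsum_int.add (hR.const_mul lam)).add (integrable_const C))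
    (Filter.Eventually.of_forall fun ω => by
      have h := vaw_regret_bound hlam
        (fun s (jk : Fin N × Fin m) => φ jk.1 (x s) (ω jk.1 jk.2))
        (fun s jk => hφ_sq jk.1 (x s) (ω jk.1 jk.2)) zero_le_two y T hy (v ω)
      have hvZ : ∀ t, v ω ⬝ᵥ (fun jk : Fin N × Fin m => φ jk.1 (x t) (ω jk.1 jk.2)) = Z t ω :=
        fun t => by
          simp only [dotProduct, Fintype.sum_prod_type, v, Z, div_mul_eq_mul_div]
      have hvR : v ω ⬝ᵥ v ω = R ω := by
        simp only [dotProduct, Fintype.sum_prod_type, v, R, ← sq, div_pow]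
      simp only [hvZ, hvR, Fintype.card_prod, Fintype.card_fin, Nat.cast_mul] at h
      exact h)
  have hsumR_int : Integrable
      (fun ω => ∑ t ∈ Finset.Icc 1 T, (Z t ω - y t) ^ 2 + lam * R ω) Q :=
    hsum_int.add (hR.const_mul lam)
  rw [integral_add hsumR_int (integrable_const C),
    integral_add hsum_int (hR.const_mul lam), integral_finsetSum _ fun t _ => hZ_int t,
    integral_const_mul, hR_eq, integral_const, probReal_univ, one_smul] at hmono
  have hsum_le := Finset.sum_le_sum fun t (_ : t ∈ Finset.Icc 1 T) => hZ_le t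
  rw [Finset.sum_add_distrib, Finset.sum_const, Nat.card_Icc, Nat.add_sub_cancel,
    nsmul_eq_mul] at hsum_le
  have hN : (T : ℝ) * ((∑ j, I j) / m) ≤ N * T * ((∑ j, I j) / m) := by
    rcases Nat.eq_zero_or_pos N with rfl | hN
    · simp
    · have : (1 : ℝ) ≤ N := by exact_mod_cast hN
      have h0 : 0 ≤ (T : ℝ) * ((∑ j, I j) / m) :=
        mul_nonneg T.cast_nonneg
          (div_nonneg (Finset.sum_nonneg fun j _ => hI_nonneg j) m.cast_nonneg)
      nlinarith
  calc _ ≤ (1 / 2) * (∑ t ∈ Finset.Icc 1 T, ∫ ω, (Z t ω - y t) ^ 2 ∂Q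
        + lam * ((∑ j, I j) / m) + C) := by gcongr
    _ ≤ (1 / 2) * ∑ t ∈ Finset.Icc 1 T, ((∑ j, f j (x t)) - y t) ^ 2
        + (lam / 2 + N * T) * ((∑ j, I j) / m) + C / 2 := by
      rw [mul_div_assoc] at hsum_le
      linarith
    _ = _ := by
      rw [hC]
      ring
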